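/- Let y = v_j be a vertex, x ∈ [v_1, v_n] a point with y < x, and i an index with j < i and v_i < x. Define Γ(w) = Φ^{s(i,w)}(x) − Φ^{s(i,w)}(y) for w ∈ [w_i^−, w_i^+]. If [α, β] ⊆ [w_i^−, w_i^+] is a subinterval on which the right-cluster partition for y under s(i, w) is the same for all w ∈ [α, β], then Γ is convex and piecewise linear on [α, β]. -/

import Mathlib

open Finset
open scoped Classical

namespace DPN

noncomputable def score (τ c : ℝ) (v w : ℕ → ℝ) (h r j : ℕ) : ℝ :=
  τ * (v h - v j) + (∑ l ∈ Finset.Ioc r j, w l) / c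

noncomputable def nextHead (τ c : ℝ) (v w : ℕ → ℝ) (h r : ℕ) : ℕ :=
  (((Finset.Ioc r h).filter (fun j =>
      ∀ j' ∈ Finset.Ioc r h, score τ c v w h r j' ≤ score τ c v w h r j)).max).getD h

noncomputable def heads (τ c : ℝ) (v w : ℕ → ℝ) (h : ℕ) : ℕ → ℕ
  | 0 => 0
  | m + 1 => nextHead τ c v w h (heads τ c v w h m)

noncomputable def hIdx (n : ℕ) (v : ℕ → ℝ) (x : ℝ) : ℕ :=
  ((Finset.Icc 1 n).filter (fun i => v i < x)).card

noncomputable def phiL (n : ℕ) (τ c : ℝ) (v w : ℕ → ℝ) (x : ℝ) : ℝ :=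
  ∑ m ∈ Finset.range n,
    ((∑ l ∈ Finset.Ioc (heads τ c v w (hIdx n v x) m) (heads τ c v w (hIdx n v x) (m + 1)), w l) *
        (τ * (x - v (heads τ c v w (hIdx n v x) (m + 1)))) +
      (∑ l ∈ Finset.Ioc (heads τ c v w (hIdx n v x) m) (heads τ c v w (hIdx n v x) (m + 1)), w l) ^ 2 /
        (2 * c))

def rv (n : ℕ) (v : ℕ → ℝ) : ℕ → ℝ := fun l => -v (n + 1 - l)

def rw (n : ℕ) (w : ℕ → ℝ) : ℕ → ℝ := fun l => w (n + 1 - l)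

noncomputable def phiR (n : ℕ) (τ c : ℝ) (v w : ℕ → ℝ) (x : ℝ) : ℝ :=
  phiL n τ c (rv n v) (rw n w) (-x)

noncomputable def phi (n : ℕ) (τ c : ℝ) (v w : ℕ → ℝ) (x : ℝ) : ℝ :=
  phiL n τ c v w x + phiR n τ c v w x

/-- The set of scenarios: each vertex weight lies in its interval. -/
def scenarios (n : ℕ) (wm wp : ℕ → ℝ) : Set (ℕ → ℝ) :=
  {s | ∀ i, 1 ≤ i → i ≤ n → wm i ≤ s i ∧ s i ≤ wp i}

/-- The gap `Γ^s(x, y) = Φ^s(x) − Φ^s(y)`. -/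
noncomputable def gap (n : ℕ) (τ c : ℝ) (v s : ℕ → ℝ) (x y : ℝ) : ℝ :=
  phi n τ c v s x - phi n τ c v s y

/-- The regret `R^s(x) = Φ^s(x) − Φ^s(m^s)` (`Φ^s(m^s)` = min of `Φ^s` on `[v_1, v_n]`). -/
noncomputable def regret (n : ℕ) (τ c : ℝ) (v s : ℕ → ℝ) (x : ℝ) : ℝ :=
  phi n τ c v s x - sInf ((fun z => phi n τ c v s z) '' Set.Icc (v 1) (v n))

/-- The maximum regret `R_max(x) = sup_{s ∈ S} R^s(x)`. -/
noncomputable def maxRegret (n : ℕ) (τ c : ℝ) (v wm wp : ℕ → ℝ) (x : ℝ) : ℝ :=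
  sSup {r | ∃ s ∈ scenarios n wm wp, r = regret n τ c v s x}

/-- The left-pseudo-bipartite scenario `s(i, w)`. -/
def pseudoBipL (wm wp : ℕ → ℝ) (i : ℕ) (w : ℝ) : ℕ → ℝ :=
  fun l => if l < i then wp l else if l = i then w else wm l

/-- The right-pseudo-bipartite scenario `s(i, w)`. -/
def pseudoBipR (wm wp : ℕ → ℝ) (i : ℕ) (w : ℝ) : ℕ → ℝ :=
  fun l => if l < i then wm l else if l = i then w else wp l

/-- The head `ρ_m` of the left cluster containing vertex `i`: the smallest cluster head `≥ i`. -/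
noncomputable def clusterHeadOf (τ c : ℝ) (v w : ℕ → ℝ) (h i : ℕ) : ℕ :=
  ((((Finset.range (h + 1)).image (heads τ c v w h)).filter (fun r => i ≤ r)).min).getD h

/-- The head `ρ_{m−1}` preceding the left cluster containing vertex `i`:
the largest cluster head `< i`. -/
noncomputable def prevClusterHeadOf (τ c : ℝ) (v w : ℕ → ℝ) (h i : ℕ) : ℕ :=
  ((((Finset.range (h + 1)).image (heads τ c v w h)).filter (fun r => r < i)).max).getD 0

/-- The weight `σ_m` of the left cluster containing vertex `i`. -/
noncomputable def clusterWeightOf (τ c : ℝ) (v w : ℕ → ℝ) (h i : ℕ) : ℝ :=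
  ∑ l ∈ Finset.Ioc (prevClusterHeadOf τ c v w h i) (clusterHeadOf τ c v w h i), w l

/-- The sequence of right cluster heads for the vertex `y = v_j`
(expressed in the coordinates of the reflected network). -/
noncomputable def rightHeads (n : ℕ) (τ c : ℝ) (v w : ℕ → ℝ) (j : ℕ) : ℕ → ℕ :=
  heads τ c (rv n v) (rw n w) (hIdx n (rv n v) (-(v j)))

/-- The sequence of left cluster heads for the vertex `y = v_j`. -/
noncomputable def leftHeads (n : ℕ) (τ c : ℝ) (v w : ℕ → ℝ) (j : ℕ) : ℕ → ℕ :=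
  heads τ c v w (hIdx n v (v j))

/-- The (original-coordinates) index of the head of the right cluster for `y = v_j`
containing vertex `i`. -/
noncomputable def rightClusterHeadOf (n : ℕ) (τ c : ℝ) (v w : ℕ → ℝ) (j i : ℕ) : ℕ :=
  n + 1 - clusterHeadOf τ c (rv n v) (rw n w) (hIdx n (rv n v) (-(v j))) (n + 1 - i)

/-- The weight of the right cluster for `y = v_j` containing vertex `i`. -/
noncomputable def rightClusterWeightOf (n : ℕ) (τ c : ℝ) (v w : ℕ → ℝ) (j i : ℕ) : ℝ :=
  clusterWeightOf τ c (rv n v) (rw n w) (hIdx n (rv n v) (-(v j))) (n + 1 - i)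

/-- `ω` is a critical weight for `v_i` with respect to the vertex `y = v_j`
(left-pseudo-bipartite case): `ω ∈ {w_i^−, w_i^+}` or the right-cluster partition for `y`
under `s(i, ·)` is not constant on any neighborhood of `ω` in `[w_i^−, w_i^+]`. -/
def criticalWeightL (n : ℕ) (τ c : ℝ) (v wm wp : ℕ → ℝ) (j i : ℕ) (ω : ℝ) : Prop :=
  ω ∈ Set.Icc (wm i) (wp i) ∧
    (ω = wm i ∨ ω = wp i ∨
      ¬ ∃ ε > (0 : ℝ), ∀ w ∈ Set.Icc (wm i) (wp i), |w - ω| < ε →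
        rightHeads n τ c v (pseudoBipL wm wp i w) j =
          rightHeads n τ c v (pseudoBipL wm wp i ω) j)

/-- `ω` is a critical weight for `v_i` with respect to the vertex `y = v_j`
(right-pseudo-bipartite case, using the left-cluster partition for `y`). -/
def criticalWeightR (n : ℕ) (τ c : ℝ) (v wm wp : ℕ → ℝ) (j i : ℕ) (ω : ℝ) : Prop :=
  ω ∈ Set.Icc (wm i) (wp i) ∧
    (ω = wm i ∨ ω = wp i ∨
      ¬ ∃ ε > (0 : ℝ), ∀ w ∈ Set.Icc (wm i) (wp i), |w - ω| < ε →
        leftHeads n τ c v (pseudoBipR wm wp i w) j =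
          leftHeads n τ c v (pseudoBipR wm wp i ω) j)

/-- `Q`: the number of right clusters for `y = v_j` under weights `w` that lie entirely
to the right of the right cluster containing `v_i` (counted via reflected cluster heads). -/
noncomputable def Qnum (n : ℕ) (τ c : ℝ) (v w : ℕ → ℝ) (j i : ℕ) : ℕ :=
  (((Finset.range (n + 1)).image (rightHeads n τ c v w j)).filter
      (fun r => 1 ≤ r ∧
        r < clusterHeadOf τ c (rv n v) (rw n w) (hIdx n (rv n v) (-(v j))) (n + 1 - i))).card

end DPN

namespace DPN

/-- The arrival time at the origin of the last evacuee of vertex `k`, when the vertices `1, …, k`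
form a single cluster headed by `k`. -/
noncomputable def arrival (τ c : ℝ) (v w : ℕ → ℝ) (k : ℕ) : ℝ :=
  (∑ l ∈ Finset.Ioc 0 k, w l) / c - τ * v k

theorem sum_Ioc_eq_sub (w : ℕ → ℝ) {r j : ℕ} (hrj : r ≤ j) :
    ∑ l ∈ Finset.Ioc r j, w l = ∑ l ∈ Finset.Ioc 0 j, w l - ∑ l ∈ Finset.Ioc 0 r, w l := by
  rw [← Finset.sum_Ioc_consecutive w (Nat.zero_le r) hrj]
  ring

theorem score_eq (τ c : ℝ) (v w : ℕ → ℝ) (h : ℕ) {r j : ℕ} (hrj : r ≤ j) :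
    score τ c v w h r j =
      arrival τ c v w j + (τ * v h - (∑ l ∈ Finset.Ioc 0 r, w l) / c) := by
  rw [score, arrival, sum_Ioc_eq_sub w hrj]
  ring

theorem nextHead_spec (τ c : ℝ) (v w : ℕ → ℝ) {h r : ℕ} (hr : r < h) :
    nextHead τ c v w h r ∈ Finset.Ioc r h ∧
      ∀ k ∈ Finset.Ioc r h, arrival τ c v w k ≤ arrival τ c v w (nextHead τ c v w h r) := by
  obtain ⟨k₀, hk₀, hmax⟩ := Finset.exists_max_image (Finset.Ioc r h) (score τ c v w h r)
    ⟨h, Finset.mem_Ioc.2 ⟨hr, le_rfl⟩⟩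
  obtain ⟨m, hm⟩ := Finset.max_of_nonempty
    (s := (Finset.Ioc r h).filter (fun j =>
      ∀ j' ∈ Finset.Ioc r h, score τ c v w h r j' ≤ score τ c v w h r j))
    ⟨k₀, Finset.mem_filter.2 ⟨hk₀, hmax⟩⟩
  have hN : nextHead τ c v w h r = m := by
    rw [nextHead, hm]
    rfl
  obtain ⟨hmem, hle⟩ := Finset.mem_filter.1 (Finset.mem_of_max hm)
  rw [hN]
  refine ⟨hmem, fun k hk => ?_⟩
  have := hle k hk
  rw [score_eq _ _ _ _ _ (Finset.mem_Ioc.1 hk).1.le,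
    score_eq _ _ _ _ _ (Finset.mem_Ioc.1 hmem).1.le] at this
  linarith

theorem nextHead_self (τ c : ℝ) (v w : ℕ → ℝ) (h : ℕ) : nextHead τ c v w h h = h := by
  simp [nextHead]
  rfl

theorem heads_le (τ c : ℝ) (v w : ℕ → ℝ) (h m : ℕ) : heads τ c v w h m ≤ h := by
  induction m with
  | zero => exact Nat.zero_le h
  | succ m ih =>
    rw [heads]
    rcases ih.lt_or_eq with hlt | heq
    · exact (Finset.mem_Ioc.1 (nextHead_spec τ c v w hlt).1).2
    · rw [heq, nextHead_self]

theorem heads_le_succ (τ c : ℝ) (v w : ℕ → ℝ) (h m : ℕ) :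
    heads τ c v w h m ≤ heads τ c v w h (m + 1) := by
  rw [heads]
  rcases (heads_le τ c v w h m).lt_or_eq with hlt | heq
  · exact (Finset.mem_Ioc.1 (nextHead_spec τ c v w hlt).1).1.le
  · rw [heq, nextHead_self]

theorem min_le_heads (τ c : ℝ) (v w : ℕ → ℝ) (h m : ℕ) : min m h ≤ heads τ c v w h m := by
  induction m with
  | zero => simp
  | succ m ih =>
    rcases (heads_le τ c v w h m).lt_or_eq with hlt | heq
    · have := (Finset.mem_Ioc.1 (nextHead_spec τ c v w hlt).1).1
      rw [heads]
      omega
    · have := heads_le_succ τ c v w h m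
      omega

theorem heads_eq_of_le (τ c : ℝ) (v w : ℕ → ℝ) {h m : ℕ} (hm : h ≤ m) :
    heads τ c v w h m = h := by
  have h₁ := heads_le τ c v w h m
  have h₂ := min_le_heads τ c v w h m
  omega

theorem arrival_le_arrival_heads_succ (τ c : ℝ) (v w : ℕ → ℝ) {h m k : ℕ}
    (hk : heads τ c v w h m < k) (hkh : k ≤ h) :
    arrival τ c v w k ≤ arrival τ c v w (heads τ c v w h (m + 1)) := by
  rw [heads]
  exact (nextHead_spec τ c v w (hk.trans_le hkh)).2 k (Finset.mem_Ioc.2 ⟨hk, hkh⟩)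

theorem hIdx_le (n : ℕ) (v : ℕ → ℝ) (x : ℝ) : hIdx n v x ≤ n := by
  simpa [hIdx] using Finset.card_filter_le (Finset.Icc 1 n) (fun i => v i < x)

/-- The evacuation time does not depend on the choice of clusters: it is expressed through the
suffix maxima `A` of the arrival times. -/
theorem phiL_eq (n : ℕ) (τ : ℝ) {c : ℝ} (hc : 0 < c) (v w : ℕ → ℝ) (x : ℝ) (A : ℕ → ℝ)
    (hA : ∀ l, 1 ≤ l → l ≤ hIdx n v x →
      IsGreatest (arrival τ c v w '' Set.Icc l (hIdx n v x)) (A l)) :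
    phiL n τ c v w x =
      (∑ l ∈ Finset.Ioc 0 (hIdx n v x), w l) * (τ * x) -
        (∑ l ∈ Finset.Ioc 0 (hIdx n v x), w l) ^ 2 / (2 * c) +
        ∑ l ∈ Finset.Ioc 0 (hIdx n v x), w l * A l := by
  set h := hIdx n v x with hh
  have key : ∀ N, ∑ m ∈ Finset.range N,
      ((∑ l ∈ Finset.Ioc (heads τ c v w h m) (heads τ c v w h (m + 1)), w l) *
          (τ * (x - v (heads τ c v w h (m + 1)))) +
        (∑ l ∈ Finset.Ioc (heads τ c v w h m) (heads τ c v w h (m + 1)), w l) ^ 2 / (2 * c)) =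
      (∑ l ∈ Finset.Ioc 0 (heads τ c v w h N), w l) * (τ * x) -
        (∑ l ∈ Finset.Ioc 0 (heads τ c v w h N), w l) ^ 2 / (2 * c) +
        ∑ l ∈ Finset.Ioc 0 (heads τ c v w h N), w l * A l := by
    intro N
    induction N with
    | zero => simp [heads]
    | succ N ih =>
      have hle := heads_le_succ τ c v w h N
      have hblock : ∑ l ∈ Finset.Ioc (heads τ c v w h N) (heads τ c v w h (N + 1)), w l * A l =
          (∑ l ∈ Finset.Ioc (heads τ c v w h N) (heads τ c v w h (N + 1)), w l) *
            arrival τ c v w (heads τ c v w h (N + 1)) := by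
        rw [Finset.sum_mul]
        refine Finset.sum_congr rfl fun l hl => ?_
        obtain ⟨hl₁, hl₂⟩ := Finset.mem_Ioc.1 hl
        have hh' := heads_le τ c v w h (N + 1)
        congr 1
        refine (hA l (by omega) (by omega)).unique
          ⟨⟨_, ⟨hl₂, hh'⟩, rfl⟩, ?_⟩
        rintro _ ⟨k, ⟨hk₁, hk₂⟩, rfl⟩
        exact arrival_le_arrival_heads_succ τ c v w (hl₁.trans_le hk₁) hk₂
      rw [Finset.sum_range_succ, ih,
        ← Finset.sum_Ioc_consecutive (fun l => w l * A l) (Nat.zero_le _) hle, hblock,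
        sum_Ioc_eq_sub w hle, arrival]
      field_simp
      ring
  rw [phiL, ← hh, key n, heads_eq_of_le τ c v w (hIdx_le n v x)]

theorem nextHead_congr (τ c : ℝ) (v : ℕ → ℝ) {w w' : ℕ → ℝ} {h : ℕ}
    (hw : ∀ l, 1 ≤ l → l ≤ h → w l = w' l) (r : ℕ) :
    nextHead τ c v w h r = nextHead τ c v w' h r := by
  have hs : ∀ j ∈ Finset.Ioc r h, score τ c v w h r j = score τ c v w' h r j := by
    intro j hj
    rw [score, score]
    congr 2
    refine Finset.sum_congr rfl fun l hl => ?_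
    rw [Finset.mem_Ioc] at hl hj
    exact hw l (by omega) (by omega)
  rw [nextHead, nextHead]
  congr 2
  refine Finset.filter_congr fun j hj => forall₂_congr fun j' hj' => ?_
  rw [hs j hj, hs j' hj']

theorem heads_congr (τ c : ℝ) (v : ℕ → ℝ) {w w' : ℕ → ℝ} {h : ℕ}
    (hw : ∀ l, 1 ≤ l → l ≤ h → w l = w' l) (m : ℕ) :
    heads τ c v w h m = heads τ c v w' h m := by
  induction m with
  | zero => rfl
  | succ m ih => rw [heads, heads, ih, nextHead_congr τ c v hw]

theorem phiL_congr (n : ℕ) (τ c : ℝ) (v : ℕ → ℝ) {w w' : ℕ → ℝ} (x : ℝ)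
    (hw : ∀ l, 1 ≤ l → l ≤ hIdx n v x → w l = w' l) :
    phiL n τ c v w x = phiL n τ c v w' x := by
  have hσ : ∀ m, ∑ l ∈ Finset.Ioc (heads τ c v w' (hIdx n v x) m)
        (heads τ c v w' (hIdx n v x) (m + 1)), w l =
      ∑ l ∈ Finset.Ioc (heads τ c v w' (hIdx n v x) m)
        (heads τ c v w' (hIdx n v x) (m + 1)), w' l := by
    intro m
    refine Finset.sum_congr rfl fun l hl => ?_
    have := heads_le τ c v w' (hIdx n v x) (m + 1)
    rw [Finset.mem_Ioc] at hl
    exact hw l (by omega) (by omega)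
  simp only [phiL, heads_congr τ c v hw, hσ]

/-- `f` is a quadratic function with leading coefficient `q`. -/
def IsQuadratic (q : ℝ) (f : ℝ → ℝ) : Prop :=
  ∃ a b : ℝ, ∀ w, f w = q * w ^ 2 + a * w + b

theorem IsQuadratic.sum {ι : Type*} (s : Finset ι) {q : ι → ℝ} {f : ι → ℝ → ℝ}
    (hf : ∀ m ∈ s, IsQuadratic (q m) (f m)) :
    IsQuadratic (∑ m ∈ s, q m) (fun w => ∑ m ∈ s, f m w) := by
  choose! a b hab using hf
  refine ⟨∑ m ∈ s, a m, ∑ m ∈ s, b m, fun w => ?_⟩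
  rw [Finset.sum_mul, Finset.sum_mul, ← Finset.sum_add_distrib, ← Finset.sum_add_distrib]
  exact Finset.sum_congr rfl fun m hm => hab m hm w

/-- For a fixed partition, the evacuation time is quadratic in the weight of one vertex. -/
theorem isQuadratic_sum_clusters (τ : ℝ) {c : ℝ} (hc : 0 < c) (v : ℕ → ℝ) (x : ℝ)
    {n i : ℕ} (hi : 1 ≤ i) {H : ℕ → ℕ} (hH₀ : H 0 = 0) (hH : ∀ m, H m ≤ H (m + 1))
    (hHn : i ≤ H n) (w₀ : ℕ → ℝ) :
    IsQuadratic (1 / (2 * c)) (fun w => ∑ m ∈ Finset.range n,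
      ((∑ l ∈ Finset.Ioc (H m) (H (m + 1)), if l = i then w else w₀ l) *
          (τ * (x - v (H (m + 1)))) +
        (∑ l ∈ Finset.Ioc (H m) (H (m + 1)), if l = i then w else w₀ l) ^ 2 / (2 * c))) := by
  have hσ : ∀ m w, (∑ l ∈ Finset.Ioc (H m) (H (m + 1)), if l = i then w else w₀ l) =
      (∑ l ∈ Finset.Ioc (H m) (H (m + 1)), if l = i then (0 : ℝ) else w₀ l) +
        (∑ l ∈ Finset.Ioc (H m) (H (m + 1)), if l = i then (1 : ℝ) else 0) * w := by
    intro m w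
    rw [Finset.sum_mul, ← Finset.sum_add_distrib]
    refine Finset.sum_congr rfl fun l _ => ?_
    split_ifs <;> ring
  have hind : ∀ m, (∑ l ∈ Finset.Ioc (H m) (H (m + 1)), if l = i then (1 : ℝ) else 0) ^ 2 =
      ∑ l ∈ Finset.Ioc (H m) (H (m + 1)), if l = i then (1 : ℝ) else 0 := by
    intro m
    rw [Finset.sum_ite_eq']
    split_ifs <;> norm_num
  have htotal : ∀ N, ∑ m ∈ Finset.range N,
      (∑ l ∈ Finset.Ioc (H m) (H (m + 1)), if l = i then (1 : ℝ) else 0) =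
      ∑ l ∈ Finset.Ioc 0 (H N), if l = i then (1 : ℝ) else 0 := by
    intro N
    induction N with
    | zero => simp [hH₀]
    | succ N ih =>
      rw [Finset.sum_range_succ, ih, Finset.sum_Ioc_consecutive _ (Nat.zero_le _) (hH N)]
  have hone : ∑ m ∈ Finset.range n,
      (∑ l ∈ Finset.Ioc (H m) (H (m + 1)), if l = i then (1 : ℝ) else 0) / (2 * c) =
      1 / (2 * c) := by
    rw [← Finset.sum_div, htotal, Finset.sum_ite_eq', if_pos (Finset.mem_Ioc.2 ⟨hi, hHn⟩)]
  rw [← hone]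
  refine IsQuadratic.sum _ fun m _ => ?_
  have hσm := hσ m
  have := hind m
  generalize (∑ l ∈ Finset.Ioc (H m) (H (m + 1)), if l = i then (1 : ℝ) else 0) = e
    at this hσm ⊢
  generalize (∑ l ∈ Finset.Ioc (H m) (H (m + 1)), if l = i then (0 : ℝ) else w₀ l) = K
    at hσm
  refine ⟨e * (τ * (x - v (H (m + 1)))) + K * e / c,
    K * (τ * (x - v (H (m + 1)))) + K ^ 2 / (2 * c), fun w => ?_⟩
  have hexp : (K + e * w) ^ 2 = K ^ 2 + 2 * K * e * w + e * w ^ 2 := by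
    linear_combination w ^ 2 * this
  simp only [hσm]
  rw [hexp]
  field_simp
  ring

/-- As a function of the weight of the vertex `i`, the left evacuation time is a quadratic function
plus a linear combination of maxima of two affine functions. -/
theorem exists_phiL_eq (n : ℕ) (τ : ℝ) {c : ℝ} (hc : 0 < c) (v : ℕ → ℝ) (x : ℝ)
    {i : ℕ} (hi : 1 ≤ i) (hih : i ≤ hIdx n v x) (w₀ : ℕ → ℝ) :
    ∃ (f : ℝ → ℝ) (C D : ℕ → ℝ), IsQuadratic (1 / (2 * c)) f ∧
      ∀ w, phiL n τ c v (fun l => if l = i then w else w₀ l) x =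
        f w + ∑ l ∈ Finset.Ico 1 i, w₀ l * max (C l) (D l + w / c) := by
  set h := hIdx n v x with hh
  set s : ℝ → ℕ → ℝ := fun w l => if l = i then w else w₀ l with hs
  have hS : ∀ w k, ∑ l ∈ Finset.Ioc 0 k, s w l =
      ∑ l ∈ Finset.Ioc 0 k, s 0 l + if i ≤ k then w else 0 := by
    intro w k
    have : ∀ l, s w l = s 0 l + if l = i then w else 0 := by
      intro l
      simp only [hs]
      split_ifs <;> ring
    rw [Finset.sum_congr rfl fun l _ => this l, Finset.sum_add_distrib, Finset.sum_ite_eq']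
    simp [Nat.pos_of_ne_zero (Nat.pos_iff_ne_zero.1 hi)]
  have harr : ∀ w k, arrival τ c v (s w) k =
      arrival τ c v (s 0) k + if i ≤ k then w / c else 0 := by
    intro w k
    rw [arrival, arrival, hS w k]
    split_ifs <;> ring
  have hC : ∀ l, l < i →
      ∃ k ∈ Finset.Ico l i, ∀ k' ∈ Finset.Ico l i,
        arrival τ c v (s 0) k' ≤ arrival τ c v (s 0) k := fun l hl =>
    Finset.exists_max_image _ _ ⟨l, Finset.mem_Ico.2 ⟨le_rfl, hl⟩⟩
  have hD : ∀ l, l ≤ h →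
      ∃ k ∈ Finset.Icc (max l i) h, ∀ k' ∈ Finset.Icc (max l i) h,
        arrival τ c v (s 0) k' ≤ arrival τ c v (s 0) k := fun l hl =>
    Finset.exists_max_image _ _ ⟨h, Finset.mem_Icc.2 ⟨max_le hl hih, le_rfl⟩⟩
  choose! p hp hpmax using hC
  choose! q hq hqmax using hD
  set C : ℕ → ℝ := fun l => arrival τ c v (s 0) (p l)
  set D : ℕ → ℝ := fun l => arrival τ c v (s 0) (q l)
  have hlow : ∀ w l, l < i →
      IsGreatest (arrival τ c v (s w) '' Set.Icc l h) (max (C l) (D l + w / c)) := by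
    intro w l hl
    have hpl := Finset.mem_Ico.1 (hp l hl)
    have hql := Finset.mem_Icc.1 (hq l (hl.le.trans hih))
    have hP : arrival τ c v (s w) (p l) = C l := by
      rw [harr, if_neg (by omega), add_zero]
    have hQ : arrival τ c v (s w) (q l) = D l + w / c := by
      rw [harr, if_pos (by omega)]
    constructor
    · rcases max_choice (C l) (D l + w / c) with hmax | hmax
      · exact ⟨p l, ⟨hpl.1, by omega⟩, by rw [hP, hmax]⟩
      · exact ⟨q l, ⟨by omega, hql.2⟩, by rw [hQ, hmax]⟩
    · rintro _ ⟨k, ⟨hk₁, hk₂⟩, rfl⟩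
      rw [harr]
      split_ifs with hik
      · refine le_max_of_le_right (add_le_add_left ?_ _)
        exact hqmax l (hl.le.trans hih) k (Finset.mem_Icc.2 ⟨by omega, hk₂⟩)
      · rw [add_zero]
        exact le_max_of_le_left (hpmax l hl k (Finset.mem_Ico.2 ⟨hk₁, by omega⟩))
  have hhigh : ∀ w l, i ≤ l → l ≤ h →
      IsGreatest (arrival τ c v (s w) '' Set.Icc l h) (D l + w / c) := by
    intro w l hl hlh
    have hql := Finset.mem_Icc.1 (hq l hlh)
    constructor
    · exact ⟨q l, ⟨by omega, hql.2⟩, by rw [harr, if_pos (by omega)]⟩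
    · rintro _ ⟨k, ⟨hk₁, hk₂⟩, rfl⟩
      rw [harr, if_pos (by omega)]
      refine add_le_add_left ?_ _
      exact hqmax l hlh k (Finset.mem_Icc.2 ⟨by omega, hk₂⟩)
  have hquad : IsQuadratic (1 / c) (fun w => ∑ l ∈ Finset.Icc i h, s w l * (D l + w / c)) := by
    have h₁ : (1 / c : ℝ) = ∑ l ∈ Finset.Icc i h, if l = i then 1 / c else 0 := by
      rw [Finset.sum_ite_eq', if_pos (Finset.mem_Icc.2 ⟨le_rfl, hih⟩)]
    rw [h₁]
    refine IsQuadratic.sum _ fun l _ => ?_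
    by_cases hl : l = i
    · refine ⟨D l, 0, fun w => ?_⟩
      simp only [hs, if_pos hl]
      ring
    · refine ⟨w₀ l / c, w₀ l * D l, fun w => ?_⟩
      simp only [hs, if_neg hl]
      ring
  obtain ⟨a, b, hab⟩ := hquad
  set S := ∑ l ∈ Finset.Ioc 0 h, s 0 l with hSdef
  refine ⟨fun w => (S + w) * (τ * x) - (S + w) ^ 2 / (2 * c) +
    ∑ l ∈ Finset.Icc i h, s w l * (D l + w / c), C, D,
    ⟨τ * x - S / c + a, S * (τ * x) - S ^ 2 / (2 * c) + b, fun w => ?_⟩, fun w => ?_⟩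
  · have := hab w
    simp only at this ⊢
    rw [this]
    field_simp
    ring
  · have hphi := phiL_eq n τ hc v (s w) x
      (fun l => if l < i then max (C l) (D l + w / c) else D l + w / c) (by
        intro l _ hlh
        split_ifs with hl
        · exact hlow w l hl
        · exact hhigh w l (by omega) hlh)
    rw [← hh, hS w h, if_pos hih, ← hSdef] at hphi
    have hsplit : Finset.Ioc 0 h = Finset.Ico 1 i ∪ Finset.Icc i h := by
      ext l
      simp only [Finset.mem_union, Finset.mem_Ioc, Finset.mem_Ico, Finset.mem_Icc]
      omega
    have hdisj : Disjoint (Finset.Ico 1 i) (Finset.Icc i h) := by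
      rw [Finset.disjoint_left]
      intro l hl hl'
      rw [Finset.mem_Ico] at hl
      rw [Finset.mem_Icc] at hl'
      omega
    have hsum₁ : ∑ l ∈ Finset.Ico 1 i,
        s w l * (if l < i then max (C l) (D l + w / c) else D l + w / c) =
        ∑ l ∈ Finset.Ico 1 i, w₀ l * max (C l) (D l + w / c) := by
      refine Finset.sum_congr rfl fun l hl => ?_
      have hl' := (Finset.mem_Ico.1 hl).2
      simp only [hs]
      rw [if_pos hl', if_neg hl'.ne]
    have hsum₂ : ∑ l ∈ Finset.Icc i h,
        s w l * (if l < i then max (C l) (D l + w / c) else D l + w / c) =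
        ∑ l ∈ Finset.Icc i h, s w l * (D l + w / c) := by
      refine Finset.sum_congr rfl fun l hl => ?_
      rw [if_neg (not_lt.2 (Finset.mem_Icc.1 hl).1)]
    rw [hsplit, Finset.sum_union hdisj, hsum₁, hsum₂] at hphi
    rw [hphi]
    ring

/-- An interval can be subdivided at finitely many prescribed points. -/
theorem exists_subdivision (B : Finset ℝ) (α β : ℝ) (hαβ : α ≤ β) :
    ∃ (k : ℕ) (t : ℕ → ℝ), t 0 = α ∧ t k = β ∧ (∀ m < k, t m ≤ t (m + 1)) ∧
      ∀ m < k, ∀ b ∈ B, b ∉ Set.Ioo (t m) (t (m + 1)) := by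
  induction hN : (B.filter (fun b => b ∈ Set.Ioo α β)).card using Nat.strong_induction_on
    generalizing α with
  | _ N ih =>
    rcases (B.filter (fun b => b ∈ Set.Ioo α β)).eq_empty_or_nonempty with hempty | hne
    · refine ⟨1, fun m => if m = 0 then α else β, rfl, rfl, ?_, ?_⟩
      · intro m hm
        obtain rfl : m = 0 := by omega
        simpa using hαβ
      · intro m hm b hb
        obtain rfl : m = 0 := by omega
        simpa using Finset.filter_eq_empty_iff.1 hempty hb
    · obtain ⟨γ, hγ, hmin⟩ := Finset.exists_min_image _ id hne
      obtain ⟨hγB, hγ₁, hγ₂⟩ := Finset.mem_filter.1 hγ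
      have hlt : (B.filter (fun b => b ∈ Set.Ioo γ β)).card < N := by
        rw [← hN]
        refine Finset.card_lt_card ⟨fun b hb => ?_, fun hsub => ?_⟩
        · obtain ⟨hb₁, hb₂, hb₃⟩ := Finset.mem_filter.1 hb
          exact Finset.mem_filter.2 ⟨hb₁, hγ₁.trans hb₂, hb₃⟩
        · exact lt_irrefl γ (Finset.mem_filter.1 (hsub hγ)).2.1
      obtain ⟨k, t, ht₀, htk, htm, htB⟩ := ih _ hlt γ hγ₂.le rfl
      refine ⟨k + 1, fun m => Nat.casesOn m α t, rfl, htk, ?_, ?_⟩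
      · rintro (_ | m) hm
        · simpa [ht₀] using hγ₁.le
        · exact htm m (by omega)
      · rintro (_ | m) hm b hb
        · rintro ⟨hb₁, hb₂⟩
          have hb₂' : b < γ := ht₀ ▸ hb₂
          exact absurd (hmin b (Finset.mem_filter.2 ⟨hb, hb₁, hb₂'.trans hγ₂⟩))
            (not_le.2 hb₂')
        · exact htB m (by omega) b hb

theorem convexOn_affine_add_sum_max {c : ℝ} (a b : ℝ) (s : Finset ℕ) (u C D : ℕ → ℝ)
    (hu : ∀ l ∈ s, 0 ≤ u l) {I : Set ℝ} (hI : Convex ℝ I) :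
    ConvexOn ℝ I (fun w => a * w + b + ∑ l ∈ s, u l * max (C l) (D l + w / c)) := by
  refine ⟨hI, fun w _ w' _ p q hp hq hpq => ?_⟩
  have hterm : ∀ l ∈ s, u l * max (C l) (D l + (p * w + q * w') / c) ≤
      p * (u l * max (C l) (D l + w / c)) + q * (u l * max (C l) (D l + w' / c)) := by
    intro l hl
    have hmax : max (C l) (D l + (p * w + q * w') / c) ≤
        p * max (C l) (D l + w / c) + q * max (C l) (D l + w' / c) := by
      refine max_le ?_ ?_
      · calc C l = p * C l + q * C l := by rw [← add_mul, hpq, one_mul]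
          _ ≤ _ := by gcongr <;> exact le_max_left _ _
      · calc D l + (p * w + q * w') / c = p * (D l + w / c) + q * (D l + w' / c) := by
              linear_combination (-D l) * hpq
          _ ≤ _ := by gcongr <;> exact le_max_right _ _
    calc _ ≤ u l * (p * max (C l) (D l + w / c) + q * max (C l) (D l + w' / c)) :=
          mul_le_mul_of_nonneg_left hmax (hu l hl)
      _ = _ := by ring
  have hsum := Finset.sum_le_sum hterm
  rw [Finset.sum_add_distrib, ← Finset.mul_sum, ← Finset.mul_sum] at hsum
  simp only [smul_eq_mul]
  have hb : b = p * b + q * b := by rw [← add_mul, hpq, one_mul]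
  linarith

theorem exists_affine_sum_max {c : ℝ} (hc : 0 < c) (s : Finset ℕ) (u C D : ℕ → ℝ) {t t' : ℝ}
    (ht : ∀ l ∈ s, c * (C l - D l) ∉ Set.Ioo t t') :
    ∃ a b : ℝ, ∀ w ∈ Set.Icc t t', ∑ l ∈ s, u l * max (C l) (D l + w / c) = a * w + b := by
  have hterm : ∀ l ∈ s, ∃ a b : ℝ, ∀ w ∈ Set.Icc t t',
      u l * max (C l) (D l + w / c) = a * w + b := by
    intro l hl
    by_cases hlt : t < c * (C l - D l)
    · refine ⟨0, u l * C l, fun w hw => ?_⟩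
      have hw' : w ≤ c * (C l - D l) := hw.2.trans (not_lt.1 fun h => ht l hl ⟨hlt, h⟩)
      have : w / c ≤ C l - D l := by rwa [div_le_iff₀' hc]
      rw [max_eq_left (by linarith)]
      ring
    · refine ⟨u l / c, u l * D l, fun w hw => ?_⟩
      have hw' : c * (C l - D l) ≤ w := (not_lt.1 hlt).trans hw.1
      have : C l - D l ≤ w / c := by rwa [le_div_iff₀' hc]
      rw [max_eq_right (by linarith)]
      ring
  choose! a b hab using hterm
  refine ⟨∑ l ∈ s, a l, ∑ l ∈ s, b l, fun w hw => ?_⟩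
  rw [Finset.sum_mul, ← Finset.sum_add_distrib]
  exact Finset.sum_congr rfl fun l hl => hab l hl w hw

theorem hIdx_eq {n h : ℕ} {v : ℕ → ℝ} {x : ℝ} (hh : h ≤ n)
    (hx : ∀ k, 1 ≤ k → k ≤ n → (v k < x ↔ k ≤ h)) : hIdx n v x = h := by
  have : (Finset.Icc 1 n).filter (fun k => v k < x) = Finset.Icc 1 h := by
    ext k
    simp only [Finset.mem_filter, Finset.mem_Icc]
    constructor
    · rintro ⟨⟨h₁, h₂⟩, h₃⟩
      exact ⟨h₁, (hx k h₁ h₂).1 h₃⟩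
    · rintro ⟨h₁, h₂⟩
      exact ⟨⟨h₁, h₂.trans hh⟩, (hx k h₁ (h₂.trans hh)).2 h₂⟩
  rw [hIdx, this, Nat.card_Icc, Nat.add_sub_cancel]

theorem exists_forall_lt_iff_le {n : ℕ} {v : ℕ → ℝ}
    (hv : ∀ k l, 1 ≤ k → k < l → l ≤ n → v k < v l) (x : ℝ) :
    ∀ k, 1 ≤ k → k ≤ n → (v k < x ↔ k ≤ hIdx n v x) := by
  obtain ⟨h, hhn, hiff⟩ : ∃ h ≤ n, ∀ k, 1 ≤ k → k ≤ n → (v k < x ↔ k ≤ h) := by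
    rcases ((Finset.Icc 1 n).filter (fun k => v k < x)).eq_empty_or_nonempty with hempty | hne
    · refine ⟨0, Nat.zero_le n, fun k h₁ h₂ => ⟨fun hk => ?_, fun hk => by omega⟩⟩
      exact absurd hk (Finset.filter_eq_empty_iff.1 hempty (Finset.mem_Icc.2 ⟨h₁, h₂⟩))
    · obtain ⟨h, hmem, hmax⟩ := Finset.exists_max_image _ id hne
      obtain ⟨hI, hlt⟩ := Finset.mem_filter.1 hmem
      refine ⟨h, (Finset.mem_Icc.1 hI).2, fun k h₁ h₂ => ⟨fun hk => ?_, fun hk => ?_⟩⟩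
      · exact hmax k (Finset.mem_filter.2 ⟨Finset.mem_Icc.2 ⟨h₁, h₂⟩, hk⟩)
      · rcases hk.lt_or_eq with hlt' | rfl
        · exact (hv k h h₁ hlt' (Finset.mem_Icc.1 hI).2).trans hlt
        · exact hlt
  rwa [hIdx_eq hhn hiff]

end DPN

open DPN

theorem stmt15 (n : ℕ) (τ c : ℝ) (hτ : 0 < τ) (hc : 0 < c) (v : ℕ → ℝ)
    (hv : ∀ i, 1 ≤ i → i < n → v i < v (i + 1))
    (wm wp : ℕ → ℝ) (hwm : ∀ i, 1 ≤ i → i ≤ n → 0 < wm i)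
    (hwmp : ∀ i, 1 ≤ i → i ≤ n → wm i ≤ wp i)
    (j : ℕ) (hj1 : 1 ≤ j) (hjn : j ≤ n)
    (x : ℝ) (hx : x ∈ Set.Icc (v 1) (v n)) (hyx : v j < x)
    (i : ℕ) (hji : j < i) (hin : i ≤ n) (hix : v i < x)
    (α β : ℝ) (hαβ : α ≤ β) (hsub : Set.Icc α β ⊆ Set.Icc (wm i) (wp i))
    (hconst : ∀ w ∈ Set.Icc α β,
      rightHeads n τ c v (pseudoBipL wm wp i w) j =
        rightHeads n τ c v (pseudoBipL wm wp i α) j) :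
    ConvexOn ℝ (Set.Icc α β)
        (fun w => gap n τ c v (pseudoBipL wm wp i w) x (v j)) ∧
      ∃ (k : ℕ) (t : ℕ → ℝ), t 0 = α ∧ t k = β ∧ (∀ m < k, t m ≤ t (m + 1)) ∧
        ∀ m < k, ∃ a b : ℝ, ∀ w ∈ Set.Icc (t m) (t (m + 1)),
          gap n τ c v (pseudoBipL wm wp i w) x (v j) = a * w + b := by
  have hmono : ∀ k l, 1 ≤ k → k < l → l ≤ n → v k < v l := by
    intro k l hk hkl
    induction l, hkl using Nat.le_induction with
    | base => exact fun hl => hv k hk hl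
    | succ l hl ih => exact fun hln => (ih (by omega)).trans (hv l (by omega) hln)
  have hrmono : ∀ k l, 1 ≤ k → k < l → l ≤ n → rv n v k < rv n v l := fun k l hk hkl hl =>
    neg_lt_neg (hmono _ _ (by omega) (by omega) (by omega))
  have hLx := exists_forall_lt_iff_le hmono x
  have hLy := exists_forall_lt_iff_le hmono (v j)
  have hRx := exists_forall_lt_iff_le hrmono (-x)
  have hRy := exists_forall_lt_iff_le hrmono (-(v j))
  obtain ⟨f, C, D, ⟨a, b, hf⟩, hphi⟩ := exists_phiL_eq n τ hc v x (by omega : 1 ≤ i)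
    ((hLx i (by omega) hin).1 hix) (pseudoBipL wm wp i 0)
  have hset : ∀ w, pseudoBipL wm wp i w =
      fun l => if l = i then w else pseudoBipL wm wp i 0 l := by
    intro w
    ext l
    simp only [pseudoBipL]
    split_ifs <;> first | rfl | omega
  have hΦLx : ∀ w, phiL n τ c v (pseudoBipL wm wp i w) x =
      f w + ∑ l ∈ Finset.Ico 1 i, wp l * max (C l) (D l + w / c) := by
    intro w
    rw [hset w, hphi w]
    congr 1
    refine Finset.sum_congr rfl fun l hl => ?_
    rw [pseudoBipL, if_pos (Finset.mem_Ico.1 hl).2]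
  have hΦLy : ∀ w, phiL n τ c v (pseudoBipL wm wp i w) (v j) =
      phiL n τ c v (pseudoBipL wm wp i 0) (v j) := by
    refine fun w => phiL_congr n τ c v _ fun l hl₁ hl₂ => ?_
    have hln := hl₂.trans (hIdx_le n v (v j))
    have hlj : l < i := by
      by_contra! hil
      exact lt_asymm ((hLy l hl₁ hln).2 hl₂) (hmono j l hj1 (by omega) hln)
    simp only [pseudoBipL, if_pos hlj]
  have hΦRx : ∀ w, phiR n τ c v (pseudoBipL wm wp i w) x =
      phiR n τ c v (pseudoBipL wm wp i 0) x := by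
    refine fun w => phiL_congr n τ c _ _ fun l hl₁ hl₂ => ?_
    have hln := hl₂.trans (hIdx_le n (rv n v) (-x))
    have hlt : x < v (n + 1 - l) := neg_lt_neg_iff.1 ((hRx l hl₁ hln).2 hl₂)
    have hne : n + 1 - l ≠ i := by
      intro heq
      rw [heq] at hlt
      exact lt_asymm hlt hix
    simp only [DPN.rw, pseudoBipL, if_neg hne]
  obtain ⟨a', b', hR⟩ := isQuadratic_sum_clusters τ hc (rv n v) (-(v j)) (n := n)
    (i := n + 1 - i) (H := rightHeads n τ c v (pseudoBipL wm wp i α) j) (by omega) rfl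
    (heads_le_succ _ _ _ _ _) (by
      rw [rightHeads, heads_eq_of_le _ _ _ _ (hIdx_le _ _ _)]
      refine (hRy _ (by omega) (by omega)).1 (neg_lt_neg ?_)
      rw [show n + 1 - (n + 1 - i) = i by omega]
      exact hmono j i hj1 hji hin) (DPN.rw n (pseudoBipL wm wp i 0))
  have hΦRy : ∀ w ∈ Set.Icc α β, phiR n τ c v (pseudoBipL wm wp i w) (v j) =
      1 / (2 * c) * w ^ 2 + a' * w + b' := by
    intro w hw
    rw [← hR w, phiR, phiL]
    have hH := hconst w hw
    rw [rightHeads] at hH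
    rw [hH]
    have hσ : ∀ m, ∑ l ∈ Finset.Ioc (rightHeads n τ c v (pseudoBipL wm wp i α) j m)
          (rightHeads n τ c v (pseudoBipL wm wp i α) j (m + 1)),
            DPN.rw n (pseudoBipL wm wp i w) l =
        ∑ l ∈ Finset.Ioc (rightHeads n τ c v (pseudoBipL wm wp i α) j m)
          (rightHeads n τ c v (pseudoBipL wm wp i α) j (m + 1)),
            if l = n + 1 - i then w else DPN.rw n (pseudoBipL wm wp i 0) l := by
      intro m
      refine Finset.sum_congr rfl fun l hl => ?_
      have hl₁ := Finset.mem_Ioc.1 hl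
      have hl₂ : rightHeads n τ c v (pseudoBipL wm wp i α) j (m + 1) ≤ n :=
        (heads_le _ _ _ _ _ _).trans (hIdx_le _ _ _)
      have hiff : n + 1 - l = i ↔ l = n + 1 - i := by omega
      rw [DPN.rw, hset w]
      simp only [hiff, DPN.rw]
    simp only [hσ]
  have hgap : ∀ w ∈ Set.Icc α β, gap n τ c v (pseudoBipL wm wp i w) x (v j) =
      (a - a') * w + (b - b' + phiR n τ c v (pseudoBipL wm wp i 0) x -
        phiL n τ c v (pseudoBipL wm wp i 0) (v j)) +
      ∑ l ∈ Finset.Ico 1 i, wp l * max (C l) (D l + w / c) := by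
    intro w hw
    rw [gap, phi, phi, hΦLx, hΦLy, hΦRx, hΦRy w hw, hf]
    ring
  generalize b - b' + phiR n τ c v (pseudoBipL wm wp i 0) x -
    phiL n τ c v (pseudoBipL wm wp i 0) (v j) = b'' at hgap
  constructor
  · refine (convexOn_affine_add_sum_max (c := c) (a - a') b'' (Finset.Ico 1 i) wp C D
      (fun l hl => ?_) (convex_Icc α β)).congr fun w hw => (hgap w hw).symm
    obtain ⟨hl₁, hl₂⟩ := Finset.mem_Ico.1 hl
    exact (hwm l hl₁ (by omega)).le.trans (hwmp l hl₁ (by omega))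
  · obtain ⟨k, t, ht₀, htk, htm, htB⟩ := exists_subdivision
      ((Finset.Ico 1 i).image fun l => c * (C l - D l)) α β hαβ
    have hge : ∀ m, m ≤ k → α ≤ t m := by
      intro m
      induction m with
      | zero => exact fun _ => ht₀.ge
      | succ m ih => exact fun hm => (ih (by omega)).trans (htm m hm)
    have hle : ∀ m, m ≤ k → t m ≤ β := by
      intro m hm
      induction hm using Nat.decreasingInduction with
      | self => exact htk.le
      | of_succ m hm ih => exact (htm m hm).trans ih
    refine ⟨k, t, ht₀, htk, htm, fun m hm => ?_⟩
    obtain ⟨p, q, hpq⟩ := exists_affine_sum_max hc (Finset.Ico 1 i) wp C D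
      (fun l hl => htB m hm _ (Finset.mem_image_of_mem _ hl))
    refine ⟨a - a' + p, b'' + q, fun w hw => ?_⟩
    rw [hgap w ⟨(hge m hm.le).trans hw.1, hw.2.trans (hle (m + 1) hm)⟩, hpq w hw]
    ring
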